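/- Let P be a finite bounded poset with an EL-labeling. Then the Möbius function satisfies μ(x,y) = (number of falling maximal chains of even length in [x,y]) − (number of falling maximal chains of odd length in [x,y]) for all x ≤ y in P. -/

import Mathlib

/-- `l` is a maximal (saturated) chain of the closed interval `[x, y]`. -/
def IsMaxChainOf {P : Type*} [PartialOrder P] (x y : P) (l : List P) : Prop :=
  l.Chain' (· ⋖ ·) ∧ l.head? = some x ∧ l.getLast? = some y

/-- The sequence of edge labels of a chain. -/
def labelSeq {P Λ : Type*} (lab : P → P → Λ) (l : List P) : List Λ :=
  List.zipWith lab l l.tail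

/-- The lexicographic (word) order on label sequences. -/
def lexLE {Λ : Type*} [LT Λ] (p q : List Λ) : Prop :=
  p = q ∨ List.Lex (· < ·) p q

/-- `lab` is an EL-labeling of the poset `P`. -/
def IsELLabeling {P Λ : Type*} [PartialOrder P] [LinearOrder Λ] (lab : P → P → Λ) : Prop :=
  ∀ x y : P, x ≤ y → ∃ c : List P,
    IsMaxChainOf x y c ∧
    (labelSeq lab c).Chain' (· < ·) ∧
    (∀ c', IsMaxChainOf x y c' → lexLE (labelSeq lab c) (labelSeq lab c')) ∧
    (∀ c', IsMaxChainOf x y c' → (labelSeq lab c').Chain' (· < ·) → c' = c)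

/-- A chain is falling if its label sequence is weakly decreasing. -/
def IsFalling {P Λ : Type*} [Preorder Λ] (lab : P → P → Λ) (l : List P) : Prop :=
  (labelSeq lab l).Chain' (· ≥ ·)

open Classical in
/-- `mu` satisfies the defining recurrence of the Möbius function of `P`. -/
def IsMoebius {P : Type*} [PartialOrder P] [Fintype P] (mu : P → P → ℤ) : Prop :=
  (∀ x : P, mu x x = 1) ∧
  (∀ x y : P, x < y → mu x y = - ∑ z ∈ Finset.univ.filter (fun z => x ≤ z ∧ z < y), mu x z) ∧
  (∀ x y : P, ¬ x ≤ y → mu x y = 0)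

theorem mc_le {P : Type*} [PartialOrder P] {y : P} : ∀ (c : List P) {x : P},
    IsMaxChainOf x y c → x ≤ y
  | [], x, h => by simp [IsMaxChainOf] at h
  | [a], x, h => by
      obtain ⟨_, h2, h3⟩ := h
      simp at h2 h3
      rw [← h2, ← h3]
  | a :: b :: c, x, h => by
      obtain ⟨h1, h2, h3⟩ := h
      simp only [List.head?_cons, Option.some.injEq] at h2
      have h1' : a ⋖ b ∧ (b :: c).IsChain (· ⋖ ·) := List.isChain_cons_cons.1 h1
      have := mc_le (b :: c) (x := b) ⟨h1'.2, by simp, by simpa using h3⟩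
      exact h2 ▸ h1'.1.le.trans this

theorem mc_finite {P : Type*} [PartialOrder P] [Fintype P] (x y : P) :
    {c : List P | IsMaxChainOf x y c}.Finite := by
  refine (List.finite_length_le P (Fintype.card P)).subset ?_
  intro c hc
  have h1 : c.IsChain (· < ·) := List.IsChain.imp (fun _ _ h => h.lt) hc.1
  have h2 : c.Nodup := (List.isChain_iff_pairwise.1 h1).imp (fun h => h.ne)
  exact h2.length_le_card

noncomputable def mcs {P : Type*} [PartialOrder P] [Fintype P] (x y : P) : Finset (List P) :=
  (mc_finite x y).toFinset

theorem mem_mcs {P : Type*} [PartialOrder P] [Fintype P] {x y : P} {c : List P} :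
    c ∈ mcs x y ↔ IsMaxChainOf x y c := by simp [mcs]

theorem mcs_empty {P : Type*} [PartialOrder P] [Fintype P] {x y : P} (h : ¬ x ≤ y) :
    mcs x y = ∅ := by
  ext c
  simp only [mem_mcs, Finset.notMem_empty, iff_false]
  exact fun hc => h (mc_le c hc)

theorem mc_cons {P : Type*} [PartialOrder P] {x y w : P} {c : List P} (hw : x ⋖ w)
    (h : IsMaxChainOf w y c) : IsMaxChainOf x y (x :: c) := by
  obtain ⟨h1, h2, h3⟩ := h
  cases c with
  | nil => simp at h2
  | cons b c =>
    simp only [List.head?_cons, Option.some.injEq] at h2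
    subst h2
    exact ⟨List.isChain_cons_cons.2 ⟨hw, h1⟩, by simp, by simpa using h3⟩

theorem labelSeq_cons {P Λ : Type*} [PartialOrder P] (lab : P → P → Λ) {x y w : P} {c : List P}
    (h : IsMaxChainOf w y c) : labelSeq lab (x :: c) = lab x w :: labelSeq lab c := by
  obtain ⟨h1, h2, h3⟩ := h
  cases c with
  | nil => simp at h2
  | cons b c =>
    simp only [List.head?_cons, Option.some.injEq] at h2
    subst h2
    simp [labelSeq]

theorem mc_length {P : Type*} [PartialOrder P] {y w : P} {c : List P}
    (h : IsMaxChainOf w y c) : c.length = (c.length - 1) + 1 := by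
  obtain ⟨h1, h2, h3⟩ := h
  cases c with
  | nil => simp at h2
  | cons b c => simp

open Classical in
theorem mcs_eq {P : Type*} [PartialOrder P] [Fintype P] (x y : P) :
    mcs x y = (if x = y then {[x]} else ∅) ∪
      (Finset.univ.filter (fun w => x ⋖ w)).biUnion
        (fun w => (mcs w y).image (fun c => x :: c)) := by
  ext c
  simp only [mem_mcs, Finset.mem_union, Finset.mem_biUnion, Finset.mem_filter, Finset.mem_univ,
    true_and, Finset.mem_image]
  constructor
  · intro h
    match c, h with
    | [], h => simp [IsMaxChainOf] at h
    | [a], h =>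
      obtain ⟨_, h2, h3⟩ := h
      simp at h2 h3
      subst h2; subst h3
      simp
    | a :: b :: c, h =>
      obtain ⟨h1, h2, h3⟩ := h
      simp only [List.head?_cons, Option.some.injEq] at h2
      subst h2
      have h1' : a ⋖ b ∧ (b :: c).IsChain (· ⋖ ·) := List.isChain_cons_cons.1 h1
      exact Or.inr ⟨b, h1'.1, b :: c, ⟨h1'.2, by simp, by simpa using h3⟩, rfl⟩
  · rintro (h | ⟨w, hw, c, hc, rfl⟩)
    · split_ifs at h with hxy
      · simp at h
        subst h; subst hxy
        exact ⟨List.isChain_singleton _, by simp, by simp⟩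
      · simp at h
    · exact mc_cons hw hc

open Classical in
theorem sum_mcs {P : Type*} [PartialOrder P] [Fintype P] (x y : P) (f : List P → ℤ) :
    ∑ c ∈ mcs x y, f c = (if x = y then f [x] else 0) +
      ∑ w ∈ Finset.univ.filter (fun w => x ⋖ w), ∑ c ∈ mcs w y, f (x :: c) := by
  rw [mcs_eq, Finset.sum_union, Finset.sum_biUnion]
  · congr 1
    · split_ifs <;> simp
    · refine Finset.sum_congr rfl fun w _ => ?_
      rw [Finset.sum_image]
      intro a _ b _ h
      simpa using h
  · intro w _ w' _ hne
    refine Finset.disjoint_left.2 fun c h1 h2 => hne ?_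
    simp only [Finset.mem_image, mem_mcs] at h1 h2
    obtain ⟨c1, h1, rfl⟩ := h1
    obtain ⟨c2, h2, h⟩ := h2
    simp at h
    subst h
    simpa [h1.2.1] using h2.2.1
  · refine Finset.disjoint_left.2 fun c h1 h2 => ?_
    split_ifs at h1
    · simp only [Finset.mem_singleton, Finset.mem_biUnion, Finset.mem_image, mem_mcs] at h1 h2
      obtain ⟨w, _, c', hc, h⟩ := h2
      subst h1
      simp at h
      subst h
      simpa using hc.2.1
    · simp at h1

open Classical in
noncomputable def fwt {P Λ : Type*} [PartialOrder P] [LinearOrder Λ] (lab : P → P → Λ)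
    (c : List P) : ℤ := if IsFalling lab c then (-1) ^ (c.length - 1) else 0

open Classical in
noncomputable def gwt {P Λ : Type*} [PartialOrder P] [LinearOrder Λ] (lab : P → P → Λ) (a : Λ)
    (c : List P) : ℤ :=
  if (a :: labelSeq lab c).IsChain (· ≥ ·) then (-1) ^ (c.length - 1) else 0

open Classical in
noncomputable def rwt {P Λ : Type*} [PartialOrder P] [LinearOrder Λ] (lab : P → P → Λ) (a : Λ)
    (c : List P) : ℤ :=
  if (a :: labelSeq lab c).IsChain (· < ·) then 1 else 0

open Classical in
theorem one_eq {P Λ : Type*} [PartialOrder P] [Fintype P] [LinearOrder Λ]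
    (lab : P → P → Λ) (hEL : IsELLabeling lab) (x y : P) (h : x ≤ y) :
    (1 : ℤ) = (if x = y then 1 else 0) +
      ∑ w ∈ Finset.univ.filter (fun w => x ⋖ w), ∑ c ∈ mcs w y, rwt lab (lab x w) c := by
  have key := sum_mcs x y (fun c => if (labelSeq lab c).IsChain (· < ·) then 1 else 0)
  obtain ⟨c, h1, h2, -, h4⟩ := hEL x y h
  have h2 : (labelSeq lab c).IsChain (· < ·) := h2
  rw [Finset.sum_eq_single c] at key
  · rw [if_pos h2] at key
    refine key.trans ?_
    congr 1
    · refine Finset.sum_congr rfl fun w _ => Finset.sum_congr rfl fun c hc => ?_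
      rw [labelSeq_cons lab (mem_mcs.1 hc), rwt]
  · intro c' hc' hne
    exact if_neg fun hr => hne (h4 c' (mem_mcs.1 hc') hr)
  · intro h; exact absurd (mem_mcs.2 h1) h

open Classical in
theorem sum_gwt {P Λ : Type*} [PartialOrder P] [Fintype P] [LinearOrder Λ]
    (lab : P → P → Λ) (hEL : IsELLabeling lab) (y : P) (x : P) : ∀ a : Λ,
    ∑ z ∈ Finset.univ.filter (fun z => z ≤ y), ∑ c ∈ mcs x z, gwt lab a c =
      ∑ c ∈ mcs x y, rwt lab a c := by
  induction x using (Finite.wellFounded_of_trans_of_irrefl (α := P) (· > ·)).induction with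
  | _ x ih =>
  intro a
  by_cases hxy : x ≤ y
  · have h1 := one_eq lab hEL x y hxy
    rw [sum_mcs x y]
    simp_rw [sum_mcs x _ (gwt lab a)]
    rw [Finset.sum_add_distrib, Finset.sum_comm]
    have e1 : ∑ z ∈ Finset.univ.filter (fun z => z ≤ y), (if x = z then gwt lab a [x] else 0)
        = 1 := by
      rw [Finset.sum_ite_eq]
      simp [hxy, gwt, labelSeq]
    have e2 : (if x = y then rwt lab a [x] else 0) = (if x = y then 1 else 0) := by
      simp [rwt, labelSeq]
    rw [e1, e2]
    conv_lhs => rw [h1]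
    rw [add_assoc, ← Finset.sum_add_distrib]
    congr 1
    refine Finset.sum_congr rfl fun w hw => ?_
    have hw' : x ⋖ w := by simpa using hw
    have e3 : ∑ z ∈ Finset.univ.filter (fun z => z ≤ y), ∑ c ∈ mcs w z, gwt lab a (x :: c)
        = (if lab x w ≤ a then -1 else 0) * ∑ c ∈ mcs w y, rwt lab (lab x w) c := by
      rw [← ih w hw'.lt, Finset.mul_sum]
      refine Finset.sum_congr rfl fun z _ => ?_
      rw [Finset.mul_sum]
      refine Finset.sum_congr rfl fun c hc => ?_
      have hc := mem_mcs.1 hc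
      simp only [gwt, labelSeq_cons lab hc, List.isChain_cons_cons (b := lab x w), List.length_cons,
        Nat.add_sub_cancel]
      conv_lhs => rw [mc_length hc]
      by_cases hl : lab x w ≤ a <;> simp [hl, pow_succ]
    have e4 : ∑ c ∈ mcs w y, rwt lab a (x :: c)
        = (if lab x w ≤ a then 0 else 1) * ∑ c ∈ mcs w y, rwt lab (lab x w) c := by
      rw [Finset.mul_sum]
      refine Finset.sum_congr rfl fun c hc => ?_
      have hc := mem_mcs.1 hc
      simp only [rwt, labelSeq_cons lab hc, List.isChain_cons_cons (b := lab x w)]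
      by_cases hl : lab x w ≤ a
      · simp [hl, not_lt.2 hl]
      · simp [hl, not_le.1 hl]
    rw [e3, e4]
    split_ifs <;> ring
  · rw [mcs_empty hxy, Finset.sum_empty]
    refine Finset.sum_eq_zero fun z hz => ?_
    have hz' : z ≤ y := by simpa using hz
    rw [mcs_empty (fun h => hxy (h.trans hz')), Finset.sum_empty]

open Classical in
theorem sum_fwt {P Λ : Type*} [PartialOrder P] [Fintype P] [LinearOrder Λ]
    (lab : P → P → Λ) (hEL : IsELLabeling lab) (x y : P) (hxy : x < y) :
    ∑ z ∈ Finset.univ.filter (fun z => z ≤ y), ∑ c ∈ mcs x z, fwt lab c = 0 := by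
  have h1 := one_eq lab hEL x y hxy.le
  rw [if_neg hxy.ne, zero_add] at h1
  simp_rw [sum_mcs x _ (fwt lab)]
  rw [Finset.sum_add_distrib, Finset.sum_comm]
  have e1 : ∑ z ∈ Finset.univ.filter (fun z => z ≤ y), (if x = z then fwt lab [x] else 0)
      = 1 := by
    rw [Finset.sum_ite_eq]
    have : IsFalling lab [x] := by
      simp only [IsFalling, labelSeq, List.tail_cons, List.zipWith_nil_right]
      exact List.isChain_nil
    simp [hxy.le, fwt, this]
  rw [e1]
  conv_lhs => rw [h1]
  rw [← Finset.sum_add_distrib]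
  refine Finset.sum_eq_zero fun w hw => ?_
  rw [← sum_gwt lab hEL, ← Finset.sum_add_distrib]
  refine Finset.sum_eq_zero fun z _ => ?_
  rw [← Finset.sum_add_distrib]
  refine Finset.sum_eq_zero fun c hc => ?_
  have hc := mem_mcs.1 hc
  have e : IsFalling lab (x :: c) ↔ (lab x w :: labelSeq lab c).IsChain (· ≥ ·) := by
    rw [← labelSeq_cons lab hc]; rfl
  rw [gwt, fwt, List.length_cons]
  simp only [e]
  rw [Nat.add_sub_cancel]
  conv_lhs => rw [mc_length hc]
  split_ifs <;> simp [pow_succ]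

open Classical in
theorem mu_eq {P Λ : Type*} [PartialOrder P] [Fintype P] [LinearOrder Λ]
    (lab : P → P → Λ) (hEL : IsELLabeling lab)
    (mu : P → P → ℤ) (hmu : IsMoebius mu) (x y : P) : x ≤ y →
    mu x y = ∑ c ∈ mcs x y, fwt lab c := by
  induction y using (Finite.wellFounded_of_trans_of_irrefl (α := P) (· < ·)).induction with
  | _ y ih =>
  intro h
  rcases h.eq_or_lt with rfl | hlt
  · rw [hmu.1, sum_mcs, if_pos rfl, Finset.sum_eq_zero]
    · have : IsFalling lab [x] := by
        simp only [IsFalling, labelSeq, List.tail_cons, List.zipWith_nil_right]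
        exact List.isChain_nil
      simp [fwt, this]
    · intro w hw
      have hw' : x ⋖ w := by simpa using hw
      rw [mcs_empty (not_le_of_gt hw'.lt), Finset.sum_empty]
  · have h0 := sum_fwt lab hEL x y hlt
    have e : Finset.univ.filter (fun z => z ≤ y)
        = insert y (Finset.univ.filter (fun z => z < y)) := by
      ext z; simp [le_iff_eq_or_lt]
    rw [e, Finset.sum_insert (by simp)] at h0
    rw [hmu.2.1 x y hlt, eq_neg_of_add_eq_zero_left h0]
    congr 1
    rw [Finset.sum_congr rfl (g := fun z => ∑ c ∈ mcs x z, fwt lab c)]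
    · refine Finset.sum_subset ?_ ?_
      · intro z; simp
      · intro z hz hz'
        have : ¬ x ≤ z := by
          intro hx
          apply hz'
          simp only [Finset.mem_filter, Finset.mem_univ, true_and] at hz ⊢
          exact ⟨hx, hz⟩
        rw [mcs_empty this, Finset.sum_empty]
    · intro z hz
      simp only [Finset.mem_filter, Finset.mem_univ, true_and] at hz
      exact ih z hz.2 hz.1

/-- For a finite bounded poset with an EL-labeling, the Möbius function of an interval
equals the number of even-length falling maximal chains minus the number of odd-length
falling maximal chains (the length of a chain being its number of edges). -/
theorem stmt9 {P Λ : Type*} [PartialOrder P] [Fintype P] [BoundedOrder P] [LinearOrder Λ]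
    (lab : P → P → Λ) (hEL : IsELLabeling lab)
    (mu : P → P → ℤ) (hmu : IsMoebius mu) :
    ∀ x y : P, x ≤ y →
      mu x y =
        ({c : List P | IsMaxChainOf x y c ∧ IsFalling lab c ∧ Even (c.length - 1)}.ncard : ℤ)
        - ({c : List P | IsMaxChainOf x y c ∧ IsFalling lab c ∧ ¬ Even (c.length - 1)}.ncard : ℤ) := by
  classical
  intro x y h
  rw [mu_eq lab hEL mu hmu x y h]
  have e1 : {c : List P | IsMaxChainOf x y c ∧ IsFalling lab c ∧ Even (c.length - 1)}
      = ((mcs x y).filter (fun c => IsFalling lab c ∧ Even (c.length - 1)) : Finset (List P)) := by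
    ext c; simp [mem_mcs]
  have e2 : {c : List P | IsMaxChainOf x y c ∧ IsFalling lab c ∧ ¬ Even (c.length - 1)}
      = ((mcs x y).filter (fun c => IsFalling lab c ∧ ¬ Even (c.length - 1)) : Finset (List P)) := by
    ext c; simp [mem_mcs]
  rw [e1, e2, Set.ncard_coe_finset, Set.ncard_coe_finset, Finset.card_filter, Finset.card_filter]
  push_cast
  rw [← Finset.sum_sub_distrib]
  refine Finset.sum_congr rfl fun c _ => ?_
  rw [fwt]
  by_cases hf : IsFalling lab c
  · by_cases he : Even (c.length - 1)
    · simp [hf, he]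
    · simp [hf, he, (Nat.not_even_iff_odd.1 he).neg_one_pow]
  · simp [hf]
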